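/- Let p ≥ 1, let x be a standard Gaussian random vector on ℝ^p, let ε ∼ N(0, σ²) with σ > 0 be independent of x, and let w, w* ∈ {0,1}^p with exactly k ≥ 1 nonzero entries each and w^T w* = ℓ where 0 ≤ ℓ ≤ k. Let Z := 1(sign(x^T w) ≠ sign(x^T w* + ε)) − 1(sign(x^T w*) ≠ sign(x^T w* + ε)). Then E[Z] = (1/π) [ arccos( ℓ/√(k(k+σ²)) ) − arccos( k/√(k(k+σ²)) ) ]. -/

import Mathlib

open scoped BigOperators
open Real MeasureTheory ProbabilityTheory

/-- `sgn λ = 1` if `λ > 0` and `-1` otherwise. -/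
noncomputable def sgn (t : ℝ) : ℝ := if 0 < t then 1 else -1

lemma sgn_ne_iff (a b : ℝ) : sgn a ≠ sgn b ↔ ¬ (0 < a ↔ 0 < b) := by
  unfold sgn
  by_cases ha : 0 < a <;> by_cases hb : 0 < b <;> simp [ha, hb] <;> norm_num

lemma meas_sgn_ne {α : Type*} [MeasurableSpace α] {f g : α → ℝ} (hf : Measurable f)
    (hg : Measurable g) : MeasurableSet {a | sgn (f a) ≠ sgn (g a)} := by
  have h : Measurable sgn := Measurable.ite measurableSet_Ioi measurable_const measurable_const
  exact (measurableSet_eq_fun (h.comp hf) (h.comp hg)).compl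

lemma angle_integral (φ : ℝ) (h0 : 0 ≤ φ) (h1 : φ ≤ π) :
    ∫ θ in Set.Ioo (-π) π, (if sgn (cos θ) ≠ sgn (cos (θ - φ)) then (1:ℝ) else 0) = 2 * φ := by
  set H : ℝ → ℝ := fun θ => if sgn (cos θ) ≠ sgn (cos (θ - φ)) then (1:ℝ) else 0 with hH
  have hper : Function.Periodic H (2 * π) := by
    intro θ
    simp only [hH]
    rw [cos_add_two_pi, show θ + 2 * π - φ = (θ - φ) + 2 * π by ring, cos_add_two_pi]
  have hmeas : Measurable H := by
    apply Measurable.ite (meas_sgn_ne (by fun_prop) (by fun_prop)) <;> fun_prop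
  have hHint : ∀ a b, IntervalIntegrable H volume a b := by
    intro a b
    apply IntervalIntegrable.mono_fun' (g := fun _ => (1:ℝ)) (by simp) hmeas.aestronglyMeasurable
    filter_upwards with θ
    simp only [hH]; split_ifs <;> simp
  have pp := pi_pos
  rw [← integral_Ioc_eq_integral_Ioo, ← intervalIntegral.integral_of_le (by linarith)]
  have e := hper.intervalIntegral_add_eq (-π) (-(π/2))
  rw [show -π + 2 * π = π by ring, show -(π/2) + 2 * π = 3 * π / 2 by ring] at e
  rw [e, ← intervalIntegral.integral_add_adjacent_intervals (hHint (-(π/2)) (φ - π/2)) (hHint _ _),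
    ← intervalIntegral.integral_add_adjacent_intervals (hHint (φ - π/2) (π/2)) (hHint _ _),
    ← intervalIntegral.integral_add_adjacent_intervals (hHint (π/2) (φ + π/2)) (hHint _ _)]
  have c1 : ∫ θ in (-(π/2))..(φ - π/2), H θ = ∫ θ in (-(π/2))..(φ - π/2), (1:ℝ) := by
    apply intervalIntegral.integral_congr_uIoo
    intro θ hθ
    rw [Set.uIoo_of_le (by linarith)] at hθ
    obtain ⟨ha, hb⟩ := hθ
    have p1 : 0 < cos θ := cos_pos_of_mem_Ioo ⟨by linarith, by linarith⟩
    have p2 : cos (θ - φ) ≤ 0 := by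
      rw [← cos_neg]; exact cos_nonpos_of_pi_div_two_le_of_le (by linarith) (by linarith)
    simp only [hH, sgn_ne_iff, p1, not_lt.mpr p2]; simp
  have c2 : ∫ θ in (φ - π/2)..(π/2), H θ = ∫ θ in (φ - π/2)..(π/2), (0:ℝ) := by
    apply intervalIntegral.integral_congr_uIoo
    intro θ hθ
    rw [Set.uIoo_of_le (by linarith)] at hθ
    obtain ⟨ha, hb⟩ := hθ
    have p1 : 0 < cos θ := cos_pos_of_mem_Ioo ⟨by linarith, by linarith⟩
    have p2 : 0 < cos (θ - φ) := cos_pos_of_mem_Ioo ⟨by linarith, by linarith⟩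
    simp only [hH, sgn_ne_iff, p1, p2]; simp
  have c3 : ∫ θ in (π/2)..(φ + π/2), H θ = ∫ θ in (π/2)..(φ + π/2), (1:ℝ) := by
    apply intervalIntegral.integral_congr_uIoo
    intro θ hθ
    rw [Set.uIoo_of_le (by linarith)] at hθ
    obtain ⟨ha, hb⟩ := hθ
    have p1 : cos θ ≤ 0 := cos_nonpos_of_pi_div_two_le_of_le (by linarith) (by linarith)
    have p2 : 0 < cos (θ - φ) := cos_pos_of_mem_Ioo ⟨by linarith, by linarith⟩
    simp only [hH, sgn_ne_iff, not_lt.mpr p1, p2]; simp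
  have c4 : ∫ θ in (φ + π/2)..(3 * π/2), H θ = ∫ θ in (φ + π/2)..(3 * π/2), (0:ℝ) := by
    apply intervalIntegral.integral_congr_uIoo
    intro θ hθ
    rw [Set.uIoo_of_le (by linarith)] at hθ
    obtain ⟨ha, hb⟩ := hθ
    have p1 : cos θ ≤ 0 := cos_nonpos_of_pi_div_two_le_of_le (by linarith) (by linarith)
    have p2 : cos (θ - φ) ≤ 0 := cos_nonpos_of_pi_div_two_le_of_le (by linarith) (by linarith)
    simp only [hH, sgn_ne_iff, not_lt.mpr p1, not_lt.mpr p2]; simp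
  rw [c1, c2, c3, c4]
  simp; ring

lemma radial_integral : ∫ r in Set.Ioi (0:ℝ), r * rexp (-(r^2/2)) = 1 := by
  have := integral_rpow_mul_exp_neg_mul_rpow (p := 2) (q := 1) (b := 1/2) (by norm_num) (by norm_num) (by norm_num)
  norm_num at this
  rw [← this]
  congr 1; ext r; congr 2; ring

lemma plane_integral (φ : ℝ) (h0 : 0 ≤ φ) (h1 : φ ≤ π) :
    ∫ q : ℝ × ℝ, (if sgn q.1 ≠ sgn (cos φ * q.1 + sin φ * q.2) then (1:ℝ) else 0)
      ∂((gaussianReal 0 1).prod (gaussianReal 0 1)) = φ / π := by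
  rw [gaussianReal_of_var_ne_zero 0 one_ne_zero,
    prod_withDensity (measurable_gaussianPDF _ _) (measurable_gaussianPDF _ _),
    integral_withDensity_eq_integral_toReal_smul (by fun_prop)
      (by filter_upwards with q; exact ENNReal.mul_lt_top (by simp [gaussianPDF]) (by simp [gaussianPDF])),
    ← Measure.volume_eq_prod, ← integral_comp_polarCoord_symm]
  have : ∀ q ∈ polarCoord.target, (q.1 • (fun q : ℝ × ℝ => (gaussianPDF 0 1 q.1 * gaussianPDF 0 1 q.2).toReal •
      (if sgn q.1 ≠ sgn (cos φ * q.1 + sin φ * q.2) then (1:ℝ) else 0)) (polarCoord.symm q)) =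
      ((2 * π)⁻¹ * (q.1 * rexp (-(q.1^2/2)))) * (if sgn (cos q.2) ≠ sgn (cos (q.2 - φ)) then (1:ℝ) else 0) := by
    rintro ⟨r, θ⟩ hq
    have hr : 0 < r := hq.1
    simp only [polarCoord_symm_apply, smul_eq_mul, ENNReal.toReal_mul, toReal_gaussianPDF]
    have e1 : cos φ * (r * cos θ) + sin φ * (r * sin θ) = r * cos (θ - φ) := by rw [cos_sub]; ring
    have e2 : (sgn (r * cos θ) ≠ sgn (r * cos (θ - φ))) = (sgn (cos θ) ≠ sgn (cos (θ - φ))) := by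
      rw [sgn_ne_iff, sgn_ne_iff, mul_pos_iff_of_pos_left hr, mul_pos_iff_of_pos_left hr]
    have e3 : gaussianPDFReal 0 1 (r * cos θ) * gaussianPDFReal 0 1 (r * sin θ) = (2 * π)⁻¹ * rexp (-(r^2/2)) := by
      simp only [gaussianPDFReal, NNReal.coe_one, mul_one, sub_zero]
      rw [mul_mul_mul_comm, ← exp_add, ← mul_inv, mul_self_sqrt (by positivity)]
      congr 2
      have := sin_sq_add_cos_sq θ
      linear_combination (-r^2/2) * this
    rw [e1, e3]
    simp only [e2]; ring
  rw [setIntegral_congr_fun polarCoord.open_target.measurableSet this, polarCoord_target,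
    Measure.volume_eq_prod, setIntegral_prod_mul (fun r : ℝ => (2 * π)⁻¹ * (r * rexp (-(r^2/2))))
      (fun θ : ℝ => if sgn (cos θ) ≠ sgn (cos (θ - φ)) then (1:ℝ) else 0),
    integral_const_mul, radial_integral, angle_integral φ h0 h1]
  field_simp

lemma cf (v : NNReal) (t : ℝ) : ∫ x, Complex.exp ((t * x : ℝ) * Complex.I) ∂gaussianReal 0 v
    = Complex.exp (-(v * t^2 / 2 : ℝ)) := by
  have := charFun_gaussianReal (μ := 0) (v := v) t
  rw [charFun_apply_real] at this
  push_cast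
  rw [this]; congr 1; simp

lemma joint_cf {p : ℕ} (v : NNReal) (c : Fin p → ℝ) (t : ℝ) :
    ∫ q : (Fin p → ℝ) × ℝ, Complex.exp (((∑ j, c j * q.1 j) + t * q.2 : ℝ) * Complex.I)
      ∂((Measure.pi fun _ : Fin p => gaussianReal 0 1).prod (gaussianReal 0 v))
    = Complex.exp (-((∑ j, c j ^ 2 + v * t^2) / 2 : ℝ)) := by
  have e : ∀ q : (Fin p → ℝ) × ℝ, Complex.exp (((∑ j, c j * q.1 j) + t * q.2 : ℝ) * Complex.I)
      = (∏ j, Complex.exp ((c j * q.1 j : ℝ) * Complex.I)) * Complex.exp ((t * q.2 : ℝ) * Complex.I) := by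
    intro q
    rw [← Complex.exp_sum, ← Complex.exp_add]
    congr 1; push_cast; rw [add_mul, Finset.sum_mul]
  simp_rw [e]
  rw [integral_prod_mul (fun a : Fin p → ℝ => ∏ j, Complex.exp ((c j * a j : ℝ) * Complex.I))
    (fun y : ℝ => Complex.exp ((t * y : ℝ) * Complex.I)),
    integral_fintype_prod_eq_prod (fun (j : Fin p) (y : ℝ) => Complex.exp ((c j * y : ℝ) * Complex.I)), cf]
  simp_rw [cf]
  rw [← Complex.exp_sum, ← Complex.exp_add]
  congr 1; push_cast; rw [Finset.sum_neg_distrib, ← Finset.sum_div]; simp; ring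

lemma pair_cf (s t : ℝ) :
    ∫ q : ℝ × ℝ, Complex.exp ((s * q.1 + t * q.2 : ℝ) * Complex.I)
      ∂((gaussianReal 0 1).prod (gaussianReal 0 1))
    = Complex.exp (-((s ^ 2 + t^2) / 2 : ℝ)) := by
  have e : ∀ q : ℝ × ℝ, Complex.exp ((s * q.1 + t * q.2 : ℝ) * Complex.I)
      = Complex.exp ((s * q.1 : ℝ) * Complex.I) * Complex.exp ((t * q.2 : ℝ) * Complex.I) := by
    intro q
    rw [← Complex.exp_add]
    congr 1; push_cast; rw [add_mul]
  simp_rw [e]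
  rw [integral_prod_mul (fun y : ℝ => Complex.exp ((s * y : ℝ) * Complex.I))
    (fun y : ℝ => Complex.exp ((t * y : ℝ) * Complex.I)), cf, cf, ← Complex.exp_add]
  congr 1; push_cast; simp; ring

lemma disagreement {p : ℕ} (v : NNReal) (w u : Fin p → ℝ) (k l : ℝ) (hk : 0 < k) (hl0 : 0 ≤ l)
    (hlk : l ≤ k) (hw : ∑ j, w j ^ 2 = k) (hu : ∑ j, u j ^ 2 = k) (hwu : ∑ j, w j * u j = l) :
    ∫ q : (Fin p → ℝ) × ℝ, (if sgn (∑ j, q.1 j * w j) ≠ sgn (∑ j, q.1 j * u j + q.2) then (1:ℝ) else 0)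
      ∂((Measure.pi fun _ : Fin p => gaussianReal 0 1).prod (gaussianReal 0 v))
    = arccos (l / √(k * (k + v))) / π := by
  have hv : (0:ℝ) ≤ v := v.2
  set ρ := l / √(k * (k + v)) with hρ
  have hpos : 0 < √(k * (k + v)) := sqrt_pos.mpr (by positivity)
  have hρ0 : 0 ≤ ρ := by positivity
  have hρ1 : ρ ≤ 1 := by
    rw [hρ, div_le_one hpos]
    apply le_sqrt_of_sq_le
    nlinarith
  set φ := arccos ρ with hφ
  have hcos : cos φ = ρ := cos_arccos (by linarith) hρ1
  set A := √k with hA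
  set B := √(k + v) with hB
  have hA0 : 0 < A := sqrt_pos.mpr hk
  have hB0 : 0 < B := sqrt_pos.mpr (by linarith)
  have hA2 : A ^ 2 = k := sq_sqrt hk.le
  have hB2 : B ^ 2 = k + v := sq_sqrt (by linarith)
  have hAB : A * B * ρ = l := by
    rw [hρ, sqrt_mul hk.le, mul_div_cancel₀ _ (by positivity)]
  have hlaw : ((Measure.pi fun _ : Fin p => gaussianReal 0 1).prod (gaussianReal 0 v)).map
      (fun q : (Fin p → ℝ) × ℝ => (∑ j, q.1 j * w j, ∑ j, q.1 j * u j + q.2))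
      = ((gaussianReal 0 1).prod (gaussianReal 0 1)).map
        (fun q : ℝ × ℝ => (A * q.1, B * (cos φ * q.1 + sin φ * q.2))) := by
    have : IsProbabilityMeasure (((Measure.pi fun _ : Fin p => gaussianReal 0 1).prod (gaussianReal 0 v)).map
      (fun q : (Fin p → ℝ) × ℝ => (∑ j, q.1 j * w j, ∑ j, q.1 j * u j + q.2))) :=
      Measure.isProbabilityMeasure_map (by fun_prop)
    have : IsProbabilityMeasure (((gaussianReal 0 1).prod (gaussianReal 0 1)).map
        (fun q : ℝ × ℝ => (A * q.1, B * (cos φ * q.1 + sin φ * q.2)))) :=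
      Measure.isProbabilityMeasure_map (by fun_prop)
    apply Measure.ext_of_charFunDual
    ext L
    rw [charFunDual_apply, charFunDual_apply, integral_map (by fun_prop) (by fun_prop),
      integral_map (by fun_prop) (by fun_prop)]
    obtain ⟨s, hs⟩ : ∃ s, s = L (1, 0) := ⟨_, rfl⟩
    obtain ⟨t, ht⟩ : ∃ t, t = L (0, 1) := ⟨_, rfl⟩
    have hL : ∀ a b : ℝ, L (a, b) = s * a + t * b := by
      intro a b
      have : ((a, b) : ℝ × ℝ) = a • (1, 0) + b • (0, 1) := by simp
      rw [this, map_add, map_smul, map_smul, hs, ht]; simp [mul_comm]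
    have e1 : ∀ q : (Fin p → ℝ) × ℝ, L (∑ j, q.1 j * w j, ∑ j, q.1 j * u j + q.2)
        = (∑ j, (s * w j + t * u j) * q.1 j) + t * q.2 := by
      intro q
      rw [hL, mul_add, Finset.mul_sum, Finset.mul_sum, ← add_assoc, ← Finset.sum_add_distrib]
      congr 1; apply Finset.sum_congr rfl; intros; ring
    have e2 : ∀ q : ℝ × ℝ, L (A * q.1, B * (cos φ * q.1 + sin φ * q.2))
        = (s * A + t * B * cos φ) * q.1 + (t * B * sin φ) * q.2 := by
      intro q
      rw [hL]; ring
    simp_rw [e1, e2]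
    rw [joint_cf, pair_cf]
    congr 4
    have e3 : ∑ j, (s * w j + t * u j) ^ 2 = s ^ 2 * k + 2 * s * t * l + t ^ 2 * k := by
      rw [← hwu]
      nth_rw 1 [← hw]
      rw [← hu, Finset.mul_sum, Finset.mul_sum, Finset.mul_sum, ← Finset.sum_add_distrib,
        ← Finset.sum_add_distrib]
      apply Finset.sum_congr rfl; intros; ring
    rw [e3]
    have h1 := sin_sq_add_cos_sq φ
    rw [← hcos] at hAB
    linear_combination (-s^2) * hA2 - 2 * s * t * hAB - t^2 * hB2 - t^2 * B^2 * h1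
  have hF : Measurable (fun z : ℝ × ℝ => if sgn z.1 ≠ sgn z.2 then (1:ℝ) else 0) :=
    Measurable.ite (meas_sgn_ne (by fun_prop) (by fun_prop)) measurable_const measurable_const
  have i1 := integral_map (μ := ((Measure.pi fun _ : Fin p => gaussianReal 0 1).prod (gaussianReal 0 v)))
    (φ := (fun q : (Fin p → ℝ) × ℝ => (∑ j, q.1 j * w j, ∑ j, q.1 j * u j + q.2)))
    (by fun_prop) (hF.aestronglyMeasurable)
  rw [hlaw, integral_map (by fun_prop) (hF.aestronglyMeasurable)] at i1
  rw [← plane_integral φ (arccos_nonneg _) (arccos_le_pi _)]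
  simp only at i1
  rw [← i1]
  congr 1; ext q
  have e2 : (sgn (A * q.1) ≠ sgn (B * (cos φ * q.1 + sin φ * q.2))) = (sgn q.1 ≠ sgn (cos φ * q.1 + sin φ * q.2)) := by
    rw [sgn_ne_iff, sgn_ne_iff, mul_pos_iff_of_pos_left hA0, mul_pos_iff_of_pos_left hB0]
  simp only [e2]

/-- Mean of the difference of misclassification indicators between a `k`-sparse binary
classifier `w` with `ℓ` true features and the ground truth `w*`. -/
theorem mean_misclassification_difference
    {Ω : Type*} [MeasurableSpace Ω] (μ : Measure Ω) [IsProbabilityMeasure μ]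
    (p k ℓ : ℕ) (hp : 1 ≤ p) (hk : 1 ≤ k) (hℓk : ℓ ≤ k)
    (σ : ℝ) (hσ : 0 < σ)
    (x : Ω → (Fin p → ℝ)) (ε : Ω → ℝ)
    (hx : Measure.map x μ = Measure.pi fun _ : Fin p => gaussianReal 0 1)
    (hε : Measure.map ε μ = gaussianReal 0 ⟨σ ^ 2, sq_nonneg σ⟩)
    (hind : IndepFun x ε μ)
    (w wstar : Fin p → ℝ)
    (hw01 : ∀ j, w j = 0 ∨ w j = 1) (hwstar01 : ∀ j, wstar j = 0 ∨ wstar j = 1)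
    (hwk : (Finset.univ.filter fun j => w j ≠ 0).card = k)
    (hwstark : (Finset.univ.filter fun j => wstar j ≠ 0).card = k)
    (hℓ : ∑ j, w j * wstar j = (ℓ : ℝ)) :
    (∫ ω, ((if sgn (∑ j, x ω j * w j) ≠ sgn (∑ j, x ω j * wstar j + ε ω) then (1 : ℝ) else 0)
        - (if sgn (∑ j, x ω j * wstar j) ≠ sgn (∑ j, x ω j * wstar j + ε ω) then (1 : ℝ) else 0)) ∂μ)
      = (1 / π) * (Real.arccos ((ℓ : ℝ) / Real.sqrt ((k : ℝ) * ((k : ℝ) + σ ^ 2)))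
          - Real.arccos ((k : ℝ) / Real.sqrt ((k : ℝ) * ((k : ℝ) + σ ^ 2)))) := by
  have mx : AEMeasurable x μ := aemeasurable_of_map_neZero (by rw [hx]; infer_instance)
  have gen : ∀ v : NNReal, NeZero (gaussianReal 0 v) := fun _ => inferInstance
  have me : AEMeasurable ε μ := aemeasurable_of_map_neZero (by rw [hε]; exact gen _)
  have hj := (indepFun_iff_map_prod_eq_prod_map_map mx me).mp hind
  rw [hx, hε] at hj
  have sq01 : ∀ f : Fin p → ℝ, (∀ j, f j = 0 ∨ f j = 1) →
      (Finset.univ.filter fun j => f j ≠ 0).card = k → ∑ j, f j ^ 2 = (k : ℝ) := by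
    intro f hf hc
    rw [← hc, Finset.card_filter]
    push_cast
    apply Finset.sum_congr rfl
    intro j _
    rcases hf j with h | h <;> simp [h]
  have hw2 := sq01 w hw01 hwk
  have hu2 := sq01 wstar hwstar01 hwstark
  have hk0 : (0:ℝ) < k := by exact_mod_cast hk
  have hlk : (ℓ:ℝ) ≤ k := by exact_mod_cast hℓk
  have key : ∀ f : Fin p → ℝ, ∀ l : ℝ, 0 ≤ l → l ≤ k → ∑ j, f j ^ 2 = (k:ℝ) →
      ∑ j, f j * wstar j = l →
      Integrable (fun ω => if sgn (∑ j, x ω j * f j) ≠ sgn (∑ j, x ω j * wstar j + ε ω) then (1 : ℝ) else 0) μ ∧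
      ∫ ω, (if sgn (∑ j, x ω j * f j) ≠ sgn (∑ j, x ω j * wstar j + ε ω) then (1 : ℝ) else 0) ∂μ
        = arccos (l / √((k:ℝ) * (k + σ ^ 2))) / π := by
    intro f l hl0 hlk hf hfl
    have hF : Measurable (fun q : (Fin p → ℝ) × ℝ =>
        if sgn (∑ j, q.1 j * f j) ≠ sgn (∑ j, q.1 j * wstar j + q.2) then (1:ℝ) else 0) :=
      Measurable.ite (meas_sgn_ne (by fun_prop) (by fun_prop)) measurable_const measurable_const
    have hd := disagreement ⟨σ ^ 2, sq_nonneg σ⟩ f wstar k l hk0 hl0 hlk hf hu2 hfl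
    rw [← hj, integral_map (mx.prodMk me) hF.aestronglyMeasurable] at hd
    refine ⟨?_, hd⟩
    refine Integrable.of_bound (hF.comp_aemeasurable (mx.prodMk me)).aestronglyMeasurable 1 ?_
    filter_upwards with ω
    split_ifs <;> simp
  obtain ⟨i1, r1⟩ := key w ℓ (by positivity) hlk hw2 hℓ
  obtain ⟨i2, r2⟩ := key wstar k hk0.le le_rfl hu2 (by rw [← hu2]; simp [sq])
  rw [integral_sub i1 i2, r1, r2]
  ring
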